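/- Let n ≥ 2, p ∈ {1,…,n−1} with gcd(n,p) = 1, q ∈ {1,…,n−1} with pq ≡ 1 (mod n), and let y be a type (i) coupling from the second interval pπ/n < y < (p/n + 1/(n(n−q)))π, so M = pπ − ny < 0. Then for every ξ ∈ A_y^+, every θ ∈ ℝ^{n−1}, and all j, ℓ ∈ {1,…,n}: Δ_j(θ)⁻¹ · L(ξ,θ)_{j,ℓ} · Δ_ℓ(θ) = [ u_j·conj(u_{σ(ℓ)}) / ( |u_j(ξ)|·|u_{σ(ℓ)}(ξ)| ) ] · L(ξ,0)_{j,ℓ}, where u = ℰ(ξ,θ) and σ(ℓ) = ℓ+n−p if 1 ≤ ℓ ≤ p, σ(ℓ) = ℓ−p if p < ℓ ≤ n. (This is the local-coordinate form of the statement that the smooth matrix L^{y,−} on ℂP^{n−1} extends the conjugated local Lax matrix.) -/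

import Mathlib

open Finset Matrix
open scoped BigOperators Real

noncomputable section

/-- Entries of the `(n-1) × (n-1)` integer matrix `A` (1-based indices):
`A_{j,k} = 1` if `1 ≤ j ≤ n-p` and `j ≤ k < j+p`, `A_{j,k} = -1` if
`n-p < j ≤ n-1` and `j+p-n ≤ k < j`, and `0` otherwise. -/
def Aent (n p : ℕ) (j k : ℕ) : ℤ :=
  if j ≤ n - p ∧ j ≤ k ∧ k < j + p then 1
  else if n - p < j ∧ j + p ≤ k + n ∧ k < j then -1
  else 0

open Classical in
/-- Entries of the binary matrix `B`: `B_{m,k} = 0` iff `k - m ≡ ℓ p (mod n)`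
for some `ℓ ∈ {1, …, n-q}`, else `1`. -/
def Bent (n p q : ℕ) (m k : ℕ) : ℤ :=
  if ∃ ℓ ∈ Finset.Icc 1 (n - q), ((k : ℤ) - (m : ℤ)) ≡ ((ℓ * p : ℕ) : ℤ) [ZMOD (n : ℤ)]
  then 0 else 1

open Classical in
/-- Entries of the binary matrix `C`: `C_{m,k} = 0` iff `k ≡ ℓ p (mod n)`
for some `ℓ ∈ {1, …, n-q}`, else `1`. -/
def Cent (n p q : ℕ) (m k : ℕ) : ℤ :=
  if ∃ ℓ ∈ Finset.Icc 1 (n - q), ((k : ℤ)) ≡ ((ℓ * p : ℕ) : ℤ) [ZMOD (n : ℤ)]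
  then 0 else 1

/-- Entries of `Ω = B - C`. -/
def Ωent (n p q : ℕ) (m k : ℕ) : ℤ := Bent n p q m k - Cent n p q m k

/-- The matrix `A` as an `(n-1) × (n-1)` integer matrix. -/
def Amat (n p : ℕ) : Matrix (Fin (n - 1)) (Fin (n - 1)) ℤ :=
  fun j k => Aent n p (j.1 + 1) (k.1 + 1)

/-- The matrix `Ω = B - C` as an `(n-1) × (n-1)` integer matrix. -/
def Ωmat (n p q : ℕ) : Matrix (Fin (n - 1)) (Fin (n - 1)) ℤ :=
  fun j k => Ωent n p q (j.1 + 1) (k.1 + 1)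

/-- Cyclic window sum `ξ_ℓ + ξ_{ℓ+1} + ⋯ + ξ_{ℓ+d-1}`. -/
def wsum (ξ : ℕ → ℝ) (ℓ d : ℕ) : ℝ := ∑ m ∈ Finset.range d, ξ (ℓ + m)

/-- First type (i) interval: `(p/n - 1/(nq))π < y < pπ/n` (so `M = pπ - ny > 0`). -/
def typeI1 (n p q : ℕ) (y : ℝ) : Prop :=
  ((p : ℝ) / n - 1 / ((n : ℝ) * q)) * Real.pi < y ∧ y < (p : ℝ) * Real.pi / n

/-- Second type (i) interval: `pπ/n < y < (p/n + 1/(n(n-q)))π` (so `M = pπ - ny < 0`). -/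
def typeI2 (n p q : ℕ) (y : ℝ) : Prop :=
  (p : ℝ) * Real.pi / n < y ∧ y < ((p : ℝ) / n + 1 / ((n : ℝ) * ((n : ℝ) - q))) * Real.pi

/-- `M = pπ - ny`. -/
def Mval (n p : ℕ) (y : ℝ) : ℝ := (p : ℝ) * Real.pi - (n : ℝ) * y

/-- Membership of `ξ` (a cyclic sequence of reals, indices `1, …, n`) in the open
domain `A_y^+`: cyclic convention `ξ_{m+n} = ξ_m`, positivity, total sum `π`, and
`sgn(M)(ξ_j + ⋯ + ξ_{j+p-1} - y) > 0` for `j = 1, …, n`. -/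
def inAy (n p : ℕ) (y : ℝ) (ξ : ℕ → ℝ) : Prop :=
  (∀ m, ξ (m + n) = ξ m) ∧
  (∀ k, 1 ≤ k → k ≤ n → 0 < ξ k) ∧
  (∑ k ∈ Finset.Icc 1 n, ξ k = Real.pi) ∧
  (∀ j, 1 ≤ j → j ≤ n → 0 < Real.sign (Mval n p y) * (wsum ξ j p - y))

/-- `|u_j(ξ)|² = sgn(M) (ξ_j + ⋯ + ξ_{j+p-1} - y)`. -/
def usq (n p : ℕ) (y : ℝ) (ξ : ℕ → ℝ) (j : ℕ) : ℝ :=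
  Real.sign (Mval n p y) * (wsum ξ j p - y)

/-- `z_ℓ(ξ, w) = sgn(sin(ny)) ∏_{d=1}^{n-1} sin(ξ_ℓ + ⋯ + ξ_{ℓ+d-1} - w)/sin(ξ_ℓ + ⋯ + ξ_{ℓ+d-1})`;
the paper's `z_ℓ(ξ, ±y)` is obtained at `w = ±y`. -/
def zfun (n : ℕ) (y : ℝ) (ξ : ℕ → ℝ) (w : ℝ) (ℓ : ℕ) : ℝ :=
  Real.sign (Real.sin ((n : ℝ) * y)) *
    ∏ d ∈ Finset.Icc 1 (n - 1), Real.sin (wsum ξ ℓ d - w) / Real.sin (wsum ξ ℓ d)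

/-- `x_j - x_ℓ` expressed through `ξ`: `ξ_ℓ + ⋯ + ξ_{j-1}` for `ℓ ≤ j`, antisymmetric. -/
def xdiff (ξ : ℕ → ℝ) (j ℓ : ℕ) : ℝ :=
  if ℓ ≤ j then wsum ξ ℓ (j - ℓ) else -(wsum ξ j (ℓ - j))

/-- `ρ(θ)_ℓ = exp(i(θ_{ℓ-1} - θ_ℓ))` (with the conventions `θ_0 = θ_n = 0` imposed
as hypotheses on `θ`). -/
def ρfun (θ : ℕ → ℝ) (ℓ : ℕ) : ℂ :=
  Complex.exp (Complex.I * ((θ (ℓ - 1) - θ ℓ : ℝ) : ℂ))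

/-- `Δ_j(θ) = exp(i Σ_{k=1}^{n-1} Ω_{j,k} θ_k)` for `1 ≤ j ≤ n-1`, and `Δ_n(θ) = 1`. -/
def Δfun (n p q : ℕ) (θ : ℕ → ℝ) (j : ℕ) : ℂ :=
  if j = n then 1
  else Complex.exp (Complex.I *
    ((∑ k ∈ Finset.Icc 1 (n - 1), (Ωent n p q j k : ℝ) * θ k : ℝ) : ℂ))

/-- The local trigonometric Lax matrix
`L(ξ,θ)_{j,ℓ} = [sin y / sin(x_j - x_ℓ + y)] v_j(ξ,y) v_ℓ(ξ,-y) ρ(θ)_ℓ`. -/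
def Lloc (n : ℕ) (y : ℝ) (ξ θ : ℕ → ℝ) (j ℓ : ℕ) : ℂ :=
  ((Real.sin y / Real.sin (xdiff ξ j ℓ + y) : ℝ) : ℂ) *
    ((Real.sqrt (zfun n y ξ y j) : ℝ) : ℂ) *
    ((Real.sqrt (zfun n y ξ (-y) ℓ) : ℝ) : ℂ) * ρfun θ ℓ

/-- The embedding map `ℰ(ξ,θ)_j = |u_j(ξ)| Δ_j(θ)^{sgn M}` for `j = 1, …, n-1`
and `ℰ(ξ,θ)_n = |u_n(ξ)|` (note `Δ_n = 1`). -/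
def Emap (n p q : ℕ) (y : ℝ) (ξ θ : ℕ → ℝ) (j : ℕ) : ℂ :=
  ((Real.sqrt (usq n p y ξ j) : ℝ) : ℂ) *
    Δfun n p q θ j ^ (if 0 < Mval n p y then (1 : ℤ) else -1)

/-- `σ(ℓ) = ℓ + n - p` if `1 ≤ ℓ ≤ p`, and `σ(ℓ) = ℓ - p` if `p < ℓ ≤ n`. -/
def σmap (n p : ℕ) (ℓ : ℕ) : ℕ := if ℓ ≤ p then ℓ + n - p else ℓ - p

/-- The Weierstrass-type function
`ws_b(z) = sin z ∏_{m=1}^∞ (1 + sin² z / sinh²(2 m b))` with `ω = π/2`, `ω' = i b`. -/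
def wsb (b : ℝ) (z : ℂ) : ℂ :=
  Complex.sin z *
    ∏' m : ℕ, (1 + Complex.sin z ^ 2 / Complex.sinh (2 * ((m : ℂ) + 1) * (b : ℂ)) ^ 2)

/-- Elliptic analogue of `zfun`, built from `ws_b` instead of `sin`. -/
def zbfun (b : ℝ) (n : ℕ) (y : ℝ) (ξ : ℕ → ℝ) (w : ℝ) (ℓ : ℕ) : ℝ :=
  Real.sign ((wsb b (((n : ℝ) * y : ℝ) : ℂ)).re) *
    ∏ d ∈ Finset.Icc 1 (n - 1),
      (wsb b ((wsum ξ ℓ d - w : ℝ) : ℂ)).re / (wsb b ((wsum ξ ℓ d : ℝ) : ℂ)).re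

/-- The local elliptic Lax matrix with spectral parameter `lam`. -/
def Lbloc (b : ℝ) (n : ℕ) (y : ℝ) (lam : ℂ) (ξ θ : ℕ → ℝ) (j ℓ : ℕ) : ℂ :=
  (wsb b ((y : ℝ) : ℂ) / wsb b lam) *
    (wsb b (((xdiff ξ j ℓ : ℝ) : ℂ) + lam) / wsb b ((xdiff ξ j ℓ + y : ℝ) : ℂ)) *
    ((Real.sqrt (zbfun b n y ξ y j) : ℝ) : ℂ) *
    ((Real.sqrt (zbfun b n y ξ (-y) ℓ) : ℝ) : ℂ) * ρfun θ ℓ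

/-- The subset `S = {ℓ p mod n : ℓ = 1, …, n-q}` of `ℤ/nℤ`. -/
def Sset (n p q : ℕ) : Finset (ZMod n) :=
  (Finset.Icc 1 (n - q)).image (fun ℓ => ((ℓ * p : ℕ) : ZMod n))

/-- The subset `S_i = {i + ℓ mod n : ℓ = 0, …, p-1}` of `ℤ/nℤ`. -/
def Siset (n p : ℕ) (i : ZMod n) : Finset (ZMod n) :=
  (Finset.range p).image (fun ℓ : ℕ => i + (ℓ : ZMod n))

/-- `I_i = |S_i ∩ S|`. -/
def Inum (n p q : ℕ) (i : ZMod n) : ℕ := (Siset n p i ∩ Sset n p q).card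

/-- The function `W_j(ξ)` of Statement 13. -/
def Wfun (n p : ℕ) (y : ℝ) (ξ : ℕ → ℝ) (j : ℕ) : ℝ :=
  (Real.sin (usq n p y ξ j) / usq n p y ξ j) *
    ((-1 : ℝ) ^ (p - 1) / Real.sin (wsum ξ j p)) *
    ∏ d ∈ (Finset.Icc 1 (n - 1)).erase p,
      Real.sin (wsum ξ j d - y) / Real.sin (wsum ξ j d)

/-- Membership in `{p, 2p, …, (n-q)p}` modulo `n`, read off after multiplication by `q = p⁻¹`. -/
lemma exists_modEq_mul_iff {n p q : ℕ} (hn : 2 ≤ n) (hq1 : 1 ≤ q)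
    (hpq : p * q ≡ 1 [MOD n]) (a : ℤ) :
    (∃ l ∈ Finset.Icc 1 (n - q), a ≡ ((l * p : ℕ) : ℤ) [ZMOD (n : ℤ)]) ↔
      1 ≤ (a * q) % n ∧ (a * q) % n ≤ (n : ℤ) - q := by
  have hpq' : (p : ℤ) * q ≡ 1 [ZMOD n] := by
    exact_mod_cast (Int.natCast_modEq_iff.mpr hpq)
  constructor
  · rintro ⟨l, hl, h⟩
    rw [Finset.mem_Icc] at hl
    have h1 : a * q ≡ l [ZMOD n] := by
      calc a * q ≡ ((l * p : ℕ) : ℤ) * q [ZMOD n] := h.mul_right _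
        _ = l * (p * q) := by push_cast; ring
        _ ≡ l * 1 [ZMOD n] := hpq'.mul_left _
        _ = l := mul_one _
    have h2 : (a * q) % n = l := by
      rw [h1.eq]
      exact Int.emod_eq_of_lt (by omega) (by omega)
    omega
  · rintro ⟨h1, h2⟩
    refine ⟨((a * q) % n).toNat, Finset.mem_Icc.mpr ⟨by omega, by omega⟩, ?_⟩
    push_cast
    rw [Int.toNat_of_nonneg (by omega)]
    calc a = a * 1 := (mul_one a).symm
      _ ≡ a * (p * q) [ZMOD n] := (hpq'.mul_left a).symm
      _ = a * q * p := by ring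
      _ ≡ (a * q) % n * p [ZMOD n] := (Int.mod_modEq _ _).symm.mul_right _

lemma Bent_eq_ite {n p q : ℕ} (hn : 2 ≤ n) (hq1 : 1 ≤ q)
    (hpq : p * q ≡ 1 [MOD n]) (m k : ℕ) :
    Bent n p q m k = if 1 ≤ (((k : ℤ) - m) * q) % n ∧ (((k : ℤ) - m) * q) % n ≤ (n : ℤ) - q
      then 0 else 1 := by
  unfold Bent
  simp only [exists_modEq_mul_iff hn hq1 hpq]

lemma Bent_sub_σmap {n p q : ℕ} (hn : 2 ≤ n) (hpn : p ≤ n - 1)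
    (hq1 : 1 ≤ q) (hqn : q ≤ n - 1) (hpq : p * q ≡ 1 [MOD n]) {ℓ k : ℕ}
    (hℓ1 : 1 ≤ ℓ) (hℓn : ℓ ≤ n) (hk1 : 1 ≤ k) (hkn : k ≤ n - 1) :
    Bent n p q (σmap n p ℓ) k =
      Bent n p q ℓ k + (if k = ℓ - 1 then 1 else 0) - (if k = ℓ then 1 else 0) := by
  have hpq' : (p : ℤ) * q ≡ 1 [ZMOD n] := by
    exact_mod_cast (Int.natCast_modEq_iff.mpr hpq)
  set a : ℤ := (k : ℤ) - ℓ with ha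
  have hr0 := Int.emod_nonneg (a * q) (b := (n : ℤ)) (by omega)
  have hrn := Int.emod_lt_of_pos (a * q) (b := (n : ℤ)) (by omega)
  have hσ : (((k : ℤ) - (σmap n p ℓ : ℕ)) * q) % n = ((a * q) % n + 1) % n := by
    have h1 : (k : ℤ) - (σmap n p ℓ : ℕ) ≡ a + p [ZMOD n] := by
      apply Int.ModEq.symm
      apply (Int.modEq_iff_dvd).mpr
      unfold σmap
      split_ifs with h
      · exact ⟨-1, by omega⟩
      · exact ⟨0, by omega⟩
    calc ((k : ℤ) - (σmap n p ℓ : ℕ)) * q ≡ (a + p) * q [ZMOD n] := h1.mul_right _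
      _ = a * q + p * q := by ring
      _ ≡ (a * q) % n + 1 [ZMOD n] := (Int.mod_modEq _ _).symm.add hpq'
  have hinv : (a * q) * p ≡ a [ZMOD n] := by
    calc a * q * p = a * (p * q) := by ring
      _ ≡ a * 1 [ZMOD n] := hpq'.mul_left a
      _ = a := mul_one a
  have hzero : (a * q) % n = 0 ↔ k = ℓ := by
    constructor
    · intro h
      have hd : (n : ℤ) ∣ a := by
        have h1 : (a * q) * p ≡ 0 * p [ZMOD n] := Int.ModEq.mul_right _ (by simpa [Int.ModEq] using h)
        rw [zero_mul] at h1
        exact Int.modEq_zero_iff_dvd.mp (hinv.symm.trans h1)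
      have := Int.eq_zero_of_abs_lt_dvd hd (by rw [abs_lt]; omega)
      omega
    · rintro rfl
      simp [ha]
  have hlast : (a * q) % n = n - q ↔ k = ℓ - 1 := by
    constructor
    · intro h
      have hd : (n : ℤ) ∣ a + 1 := by
        have h1 : (a * q) ≡ n - q [ZMOD n] := by
          rw [← h]
          exact (Int.mod_modEq _ _).symm
        have h2 : (a * q) * p ≡ -1 [ZMOD n] := by
          calc (a * q) * p ≡ (n - q) * p [ZMOD n] := h1.mul_right _
            _ = -(p * q) + n * p := by ring
            _ ≡ -(p * q) [ZMOD n] := by simp [Int.ModEq]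
            _ ≡ -1 [ZMOD n] := hpq'.neg
        have h3 := (hinv.symm.trans h2).add_right 1
        exact Int.modEq_zero_iff_dvd.mp (by simpa using h3)
      have := Int.eq_zero_of_abs_lt_dvd hd (by rw [abs_lt]; omega)
      omega
    · intro h
      have : a = -1 := by omega
      rw [this]
      have h2 : (-1 : ℤ) * q ≡ n - q [ZMOD n] := by
        apply (Int.modEq_iff_dvd).mpr
        exact ⟨1, by ring⟩
      rw [h2.eq]
      exact Int.emod_eq_of_lt (by omega) (by omega)
  rw [Bent_eq_ite hn hq1 hpq, Bent_eq_ite hn hq1 hpq, hσ, ← ha]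
  generalize (a * q) % n = r at *
  have hmod : (r + 1) % (n : ℤ) = if r + 1 = n then 0 else r + 1 := by
    split_ifs with h
    · simp [h]
    · exact Int.emod_eq_of_lt (by omega) (by omega)
  rw [hmod]
  split_ifs <;> omega

lemma Ωent_self (n p q k : ℕ) : Ωent n p q n k = 0 := by
  have h (l : ℕ) : ((k : ℤ) - n ≡ ((l * p : ℕ) : ℤ) [ZMOD n]) ↔
      ((k : ℤ) ≡ ((l * p : ℕ) : ℤ) [ZMOD n]) := by
    simp [Int.ModEq]
  simp only [Ωent, Bent, Cent, h, sub_self]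

lemma Δfun_eq_exp (n p q : ℕ) (θ : ℕ → ℝ) (j : ℕ) :
    Δfun n p q θ j = Complex.exp (Complex.I *
      ((∑ k ∈ Finset.Icc 1 (n - 1), (Ωent n p q j k : ℝ) * θ k : ℝ) : ℂ)) := by
  unfold Δfun
  split_ifs with h
  · simp [h, Ωent_self]
  · rfl

lemma conj_Δfun (n p q : ℕ) (θ : ℕ → ℝ) (j : ℕ) :
    starRingEnd ℂ (Δfun n p q θ j) = (Δfun n p q θ j)⁻¹ := by
  rw [Δfun_eq_exp, ← Complex.exp_conj, ← Complex.exp_neg, map_mul, Complex.conj_I,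
    Complex.conj_ofReal, neg_mul]

lemma Δfun_σmap {n p q : ℕ} (hn : 2 ≤ n) (hpn : p ≤ n - 1)
    (hq1 : 1 ≤ q) (hqn : q ≤ n - 1) (hpq : p * q ≡ 1 [MOD n])
    {θ : ℕ → ℝ} (hθ0 : θ 0 = 0) (hθn : θ n = 0) {ℓ : ℕ} (hℓ1 : 1 ≤ ℓ) (hℓn : ℓ ≤ n) :
    Δfun n p q θ (σmap n p ℓ) = Δfun n p q θ ℓ * ρfun θ ℓ := by
  rw [Δfun_eq_exp, Δfun_eq_exp, ρfun, ← Complex.exp_add, ← mul_add, ← Complex.ofReal_add]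
  congr 3
  have hterm : ∀ k ∈ Finset.Icc 1 (n - 1), (Ωent n p q (σmap n p ℓ) k : ℝ) * θ k =
      (Ωent n p q ℓ k : ℝ) * θ k +
        ((if k = ℓ - 1 then θ k else 0) - (if k = ℓ then θ k else 0)) := by
    intro k hk
    rw [Finset.mem_Icc] at hk
    have hC : Cent n p q (σmap n p ℓ) k = Cent n p q ℓ k := rfl
    rw [Ωent, Ωent, hC, Bent_sub_σmap hn hpn hq1 hqn hpq hℓ1 hℓn hk.1 hk.2]
    split_ifs <;> push_cast <;> ring
  rw [Finset.sum_congr rfl hterm, Finset.sum_add_distrib, Finset.sum_sub_distrib,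
    Finset.sum_ite_eq', Finset.sum_ite_eq']
  congr 2
  · split_ifs with h
    · rfl
    · rw [Finset.mem_Icc] at h
      rw [show ℓ - 1 = 0 by omega, hθ0]
  · split_ifs with h
    · rfl
    · rw [Finset.mem_Icc] at h
      rw [show ℓ = n by omega, hθn]

/-- For a type (i) coupling from the second interval (`M < 0`):
`Δ_j(θ)⁻¹ L(ξ,θ)_{j,ℓ} Δ_ℓ(θ) = [u_j conj(u_{σ(ℓ)}) / (|u_j(ξ)| |u_{σ(ℓ)}(ξ)|)] · L(ξ,0)_{j,ℓ}`
with `u = ℰ(ξ,θ)`. -/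
theorem stmt7 (n p q : ℕ) (hn : 2 ≤ n) (hp1 : 1 ≤ p) (hpn : p ≤ n - 1)
    (hgcd : Nat.gcd n p = 1) (hq1 : 1 ≤ q) (hqn : q ≤ n - 1)
    (hpq : p * q ≡ 1 [MOD n])
    (y : ℝ) (hy : typeI2 n p q y)
    (ξ : ℕ → ℝ) (hξ : inAy n p y ξ)
    (θ : ℕ → ℝ) (hθ0 : θ 0 = 0) (hθn : θ n = 0)
    (j ℓ : ℕ) (hj1 : 1 ≤ j) (hjn : j ≤ n) (hℓ1 : 1 ≤ ℓ) (hℓn : ℓ ≤ n) :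
    (Δfun n p q θ j)⁻¹ * Lloc n y ξ θ j ℓ * Δfun n p q θ ℓ =
      (Emap n p q y ξ θ j * starRingEnd ℂ (Emap n p q y ξ θ (σmap n p ℓ))) /
        (((Real.sqrt (usq n p y ξ j) * Real.sqrt (usq n p y ξ (σmap n p ℓ)) : ℝ)) : ℂ) *
        Lloc n y ξ (fun _ => 0) j ℓ := by
  have hM : ¬ 0 < Mval n p y := by
    have hn0 : (0 : ℝ) < n := by exact_mod_cast (by omega : 0 < n)
    have h := (div_lt_iff₀ hn0).mp hy.1
    unfold Mval
    linarith
  have hσ1 : 1 ≤ σmap n p ℓ := by unfold σmap; split_ifs <;> omega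
  have hσn : σmap n p ℓ ≤ n := by unfold σmap; split_ifs <;> omega
  have hne {i : ℕ} (h1 : 1 ≤ i) (h2 : i ≤ n) : ((Real.sqrt (usq n p y ξ i) : ℝ) : ℂ) ≠ 0 := by
    exact_mod_cast (Real.sqrt_pos.mpr (hξ.2.2.2 i h1 h2)).ne'
  have huj := hne hj1 hjn
  have huσ := hne hσ1 hσn
  have hρ : ρfun (fun _ => 0) ℓ = 1 := by simp [ρfun]
  simp only [Emap, if_neg hM, _root_.zpow_neg_one, map_mul, map_inv₀, conj_Δfun, inv_inv,
    Complex.conj_ofReal, Lloc, hρ]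
  rw [Δfun_σmap hn hpn hq1 hqn hpq hθ0 hθn hℓ1 hℓn, Complex.ofReal_mul,
    mul_mul_mul_comm, mul_div_cancel_left₀ _ (mul_ne_zero huj huσ)]
  ring

end
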